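/- arXiv:2010.08393 — 3 statements merged into one kernel-verified Lean document; each statement's English description precedes it below -/
import Mathlib

section
/- Every projective automorphism of the Roman surface is a Euclidean isomorphism: if A ∈ GL₄(ℂ) induces a transformation of ℙ³(ℂ) with A·V = V, then A also maps the set E₃ = {[z] ∈ ℙ³(ℂ) : z₀ = 0 and z₁² + z₂² + z₃² = 0} onto itself. -/
/-- The quartic form defining the Roman (Steiner) surface. -/
noncomputable def romanQ (z : Fin 4 → ℂ) : ℂ :=
  (z 1) ^ 2 * (z 2) ^ 2 + (z 1) ^ 2 * (z 3) ^ 2 + (z 2) ^ 2 * (z 3) ^ 2 -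
    z 0 * z 1 * z 2 * z 3

/-- The Roman surface `V ⊆ ℙ³(ℂ)`. -/
noncomputable def romanV : Set (Projectivization ℂ (Fin 4 → ℂ)) :=
  {p | romanQ p.rep = 0}

/-- The "Euclidean absolute conic" `E₃ ⊆ ℙ³(ℂ)`. -/
noncomputable def euclE : Set (Projectivization ℂ (Fin 4 → ℂ)) :=
  {p | p.rep 0 = 0 ∧ (p.rep 1) ^ 2 + (p.rep 2) ^ 2 + (p.rep 3) ^ 2 = 0}

/-- The projective transformation of `ℙ³(ℂ)` induced by an invertible matrix. -/
noncomputable def act (A : GL (Fin 4) ℂ) :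
    Projectivization ℂ (Fin 4 → ℂ) → Projectivization ℂ (Fin 4 → ℂ) :=
  Projectivization.map (Matrix.mulVecLin (A : Matrix (Fin 4) (Fin 4) ℂ))
    (by
      intro x y h
      apply (Matrix.GeneralLinearGroup.toLin A).toLinearEquiv.injective
      simpa [Matrix.GeneralLinearGroup.toLin_apply] using h)

lemma linear_forms_mul_eq_zero {b₁ b₂ c₁ c₂ : ℂ}
    (h : ∀ s t : ℂ, (s * b₁ + t * b₂) * (s * c₁ + t * c₂) = 0) :
    (b₁ = 0 ∧ b₂ = 0) ∨ (c₁ = 0 ∧ c₂ = 0) := by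
  have h₁ := h 1 0
  have h₂ := h 0 1
  have h₃ := h 1 1
  simp only [one_mul, zero_mul, add_zero, zero_add, mul_eq_zero] at h₁ h₂ h₃
  grind

lemma exists_smul_eq_of_det_eq_zero {a₁ a₂ b₁ b₂ : ℂ} (ha : ¬(a₁ = 0 ∧ a₂ = 0))
    (h : a₁ * b₂ = a₂ * b₁) : ∃ k, b₁ = k * a₁ ∧ b₂ = k * a₂ := by
  by_cases h₁ : a₁ = 0
  · have h₂ : a₂ ≠ 0 := fun h₂ => ha ⟨h₁, h₂⟩
    refine ⟨b₂ / a₂, ?_, by field_simp⟩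
    field_simp
    linear_combination -h
  · refine ⟨b₁ / a₁, by field_simp, ?_⟩
    field_simp
    linear_combination h

/-- A line on the Roman surface does not have its three last coordinate forms nonzero and
proportional. -/
lemma not_proportional_of_line {a₁ a₂ b₁ b₂ c₁ c₂ d₁ d₂ : ℂ}
    (H : ∀ s t : ℂ, (s * a₁ + t * a₂) ^ 2 * (s * b₁ + t * b₂) ^ 2
      + (s * a₁ + t * a₂) ^ 2 * (s * c₁ + t * c₂) ^ 2
      + (s * b₁ + t * b₂) ^ 2 * (s * c₁ + t * c₂) ^ 2
      - (s * d₁ + t * d₂) * (s * a₁ + t * a₂) * (s * b₁ + t * b₂) * (s * c₁ + t * c₂) = 0)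
    (I : ∀ s t : ℂ, s * d₁ + t * d₂ = 0 → s * a₁ + t * a₂ = 0 → s * b₁ + t * b₂ = 0 →
      s * c₁ + t * c₂ = 0 → s = 0 ∧ t = 0)
    (ha : ¬(a₁ = 0 ∧ a₂ = 0)) (hb : ¬(b₁ = 0 ∧ b₂ = 0)) (hc : ¬(c₁ = 0 ∧ c₂ = 0))
    (hab : a₁ * b₂ = a₂ * b₁) (hac : a₁ * c₂ = a₂ * c₁) : False := by
  obtain ⟨β, rfl, rfl⟩ := exists_smul_eq_of_det_eq_zero ha hab
  obtain ⟨γ, rfl, rfl⟩ := exists_smul_eq_of_det_eq_zero ha hac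
  have hβ : β ≠ 0 := by rintro rfl; simp at hb
  have hγ : γ ≠ 0 := by rintro rfl; simp at hc
  set m := β ^ 2 + γ ^ 2 + β ^ 2 * γ ^ 2
  have key : ∀ s t : ℂ, (s * a₁ + t * a₂) *
      (s * (m * a₁ - β * γ * d₁) + t * (m * a₂ - β * γ * d₂)) = 0 := by
    intro s t
    have h : (s * a₁ + t * a₂) ^ 3 *
        (s * (m * a₁ - β * γ * d₁) + t * (m * a₂ - β * γ * d₂)) = 0 := by
      linear_combination H s t
    rcases mul_eq_zero.1 h with h | h
    · rw [pow_eq_zero_iff (by norm_num)] at h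
      rw [h, zero_mul]
    · rw [h, mul_zero]
  rcases linear_forms_mul_eq_zero key with h | ⟨h₁, h₂⟩
  · exact ha h
  · have hd : β * γ * (a₂ * d₁ + -a₁ * d₂) = 0 := by
      linear_combination -a₂ * h₁ + a₁ * h₂
    have hd' := (mul_eq_zero.1 hd).resolve_left (mul_ne_zero hβ hγ)
    have := I a₂ (-a₁) hd' (by ring) (by ring) (by ring)
    exact ha ⟨neg_eq_zero.1 this.2, this.1⟩

/-- The only lines on the Roman surface are its three double lines. -/
lemma line_classification {a₁ a₂ b₁ b₂ c₁ c₂ d₁ d₂ : ℂ}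
    (H : ∀ s t : ℂ, (s * a₁ + t * a₂) ^ 2 * (s * b₁ + t * b₂) ^ 2
      + (s * a₁ + t * a₂) ^ 2 * (s * c₁ + t * c₂) ^ 2
      + (s * b₁ + t * b₂) ^ 2 * (s * c₁ + t * c₂) ^ 2
      - (s * d₁ + t * d₂) * (s * a₁ + t * a₂) * (s * b₁ + t * b₂) * (s * c₁ + t * c₂) = 0)
    (I : ∀ s t : ℂ, s * d₁ + t * d₂ = 0 → s * a₁ + t * a₂ = 0 → s * b₁ + t * b₂ = 0 →
      s * c₁ + t * c₂ = 0 → s = 0 ∧ t = 0) :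
    ((b₁ = 0 ∧ b₂ = 0) ∧ c₁ = 0 ∧ c₂ = 0) ∨ ((a₁ = 0 ∧ a₂ = 0) ∧ c₁ = 0 ∧ c₂ = 0) ∨
      ((a₁ = 0 ∧ a₂ = 0) ∧ b₁ = 0 ∧ b₂ = 0) := by
  by_cases ha : a₁ = 0 ∧ a₂ = 0
  · obtain ⟨rfl, rfl⟩ := ha
    have := linear_forms_mul_eq_zero (b₁ := b₁) (b₂ := b₂) (c₁ := c₁) (c₂ := c₂) fun s t => by
      rw [← sq_eq_zero_iff]
      linear_combination H s t
    tauto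
  by_cases hb : b₁ = 0 ∧ b₂ = 0
  · obtain ⟨rfl, rfl⟩ := hb
    have := linear_forms_mul_eq_zero (b₁ := a₁) (b₂ := a₂) (c₁ := c₁) (c₂ := c₂) fun s t => by
      rw [← sq_eq_zero_iff]
      linear_combination H s t
    tauto
  by_cases hc : c₁ = 0 ∧ c₂ = 0
  · obtain ⟨rfl, rfl⟩ := hc
    have := linear_forms_mul_eq_zero (b₁ := a₁) (b₂ := a₂) (c₁ := b₁) (c₂ := b₂) fun s t => by
      rw [← sq_eq_zero_iff]
      linear_combination H s t
    tauto
  exfalso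
  have e₁ : (a₁ * b₂ - a₂ * b₁) * (a₁ * c₂ - a₂ * c₁) = 0 := by
    rw [← sq_eq_zero_iff]
    linear_combination H a₂ (-a₁)
  have e₂ : (a₁ * b₂ - a₂ * b₁) * (b₁ * c₂ - b₂ * c₁) = 0 := by
    rw [← sq_eq_zero_iff]
    linear_combination H b₂ (-b₁)
  have e₃ : (a₁ * c₂ - a₂ * c₁) * (b₁ * c₂ - b₂ * c₁) = 0 := by
    rw [← sq_eq_zero_iff]
    linear_combination H c₂ (-c₁)
  by_cases hab : a₁ * b₂ - a₂ * b₁ = 0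
  · rcases mul_eq_zero.1 e₃ with hac | hbc
    · exact not_proportional_of_line H I ha hb hc (sub_eq_zero.1 hab) (sub_eq_zero.1 hac)
    · exact not_proportional_of_line (a₁ := b₁) (a₂ := b₂) (b₁ := a₁) (b₂ := a₂)
        (c₁ := c₁) (c₂ := c₂) (d₁ := d₁) (d₂ := d₂)
        (fun s t => by linear_combination H s t) (fun s t h₀ h₁ h₂ h₃ => I s t h₀ h₂ h₁ h₃)
        hb ha hc (by linear_combination -hab) (sub_eq_zero.1 hbc)
  · have hac := (mul_eq_zero.1 e₁).resolve_left hab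
    have hbc := (mul_eq_zero.1 e₂).resolve_left hab
    exact not_proportional_of_line (a₁ := c₁) (a₂ := c₂) (b₁ := a₁) (b₂ := a₂)
        (c₁ := b₁) (c₂ := b₂) (d₁ := d₁) (d₂ := d₂)
        (fun s t => by linear_combination H s t) (fun s t h₀ h₁ h₂ h₃ => I s t h₀ h₂ h₃ h₁)
        hc ha hb (by linear_combination -hac) (by linear_combination -hbc)

/-- A monomial substitution preserving the Roman surface is, up to scaling, orthogonal. -/
lemma monomial_automorphism {l a₁ a₂ a₃ b₁ b₂ b₃ : ℂ} (hb₁ : b₁ ≠ 0) (hb₂ : b₂ ≠ 0)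
    (hb₃ : b₃ ≠ 0)
    (H : ∀ x y z w : ℂ, x ^ 2 * y ^ 2 + x ^ 2 * z ^ 2 + y ^ 2 * z ^ 2 - w * x * y * z = 0 →
      (b₁ * x) ^ 2 * (b₂ * y) ^ 2 + (b₁ * x) ^ 2 * (b₃ * z) ^ 2 + (b₂ * y) ^ 2 * (b₃ * z) ^ 2
        - (l * w + a₁ * x + a₂ * y + a₃ * z) * (b₁ * x) * (b₂ * y) * (b₃ * z) = 0) :
    (a₁ = 0 ∧ a₂ = 0 ∧ a₃ = 0) ∧ b₂ ^ 2 = b₁ ^ 2 ∧ b₃ ^ 2 = b₁ ^ 2 := by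
  have hb : b₁ * b₂ * b₃ ≠ 0 := mul_ne_zero (mul_ne_zero hb₁ hb₂) hb₃
  have p₁ := H 1 1 1 3 (by norm_num)
  have p₂ := H 1 1 (-1) (-3) (by norm_num)
  have p₃ := H 1 (-1) 1 (-3) (by norm_num)
  have p₄ := H (-1) 1 1 (-3) (by norm_num)
  have p₅ := H 2 1 1 (9 / 2) (by norm_num)
  have p₆ := H 1 2 1 (9 / 2) (by norm_num)
  have s₁ : a₂ + a₃ = 0 := by
    apply (mul_eq_zero.1 (?_ : b₁ * b₂ * b₃ * (a₂ + a₃) = 0)).resolve_left hb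
    linear_combination (-1 / 2) * (p₁ - p₄)
  have s₂ : a₁ + a₃ = 0 := by
    apply (mul_eq_zero.1 (?_ : b₁ * b₂ * b₃ * (a₁ + a₃) = 0)).resolve_left hb
    linear_combination (-1 / 2) * (p₁ - p₃)
  have s₃ : a₁ + a₂ = 0 := by
    apply (mul_eq_zero.1 (?_ : b₁ * b₂ * b₃ * (a₁ + a₂) = 0)).resolve_left hb
    linear_combination (-1 / 2) * (p₁ - p₂)
  have t₁ : a₁ = 0 := by linear_combination (s₂ + s₃ - s₁) / 2
  have t₂ : a₂ = 0 := by linear_combination (s₁ + s₃ - s₂) / 2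
  have t₃ : a₃ = 0 := by linear_combination (s₁ + s₂ - s₃) / 2
  subst t₁ t₂ t₃
  have u₁ : b₂ ^ 2 * b₃ ^ 2 = l * (b₁ * b₂ * b₃) := by
    linear_combination (4 * p₁ - p₅) / 3
  have u₂ : b₁ ^ 2 * b₃ ^ 2 = l * (b₁ * b₂ * b₃) := by
    linear_combination (4 * p₁ - p₆) / 3
  have u₃ : b₁ ^ 2 * b₂ ^ 2 = l * (b₁ * b₂ * b₃) := by
    linear_combination p₁ - u₁ - u₂
  refine ⟨⟨rfl, rfl, rfl⟩, ?_, ?_⟩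
  · apply mul_right_cancel₀ (pow_ne_zero 2 hb₃)
    rw [u₁, u₂]
  · apply mul_right_cancel₀ (pow_ne_zero 2 hb₂)
    linear_combination u₁ - u₃

/-- A monomial substitution preserving the Roman surface preserves the absolute conic. -/
lemma monomial_preserves_conic {l a₁ a₂ a₃ b₁ b₂ b₃ x y z : ℂ} (hb₁ : b₁ ≠ 0) (hb₂ : b₂ ≠ 0)
    (hb₃ : b₃ ≠ 0)
    (H : ∀ x y z w : ℂ, x ^ 2 * y ^ 2 + x ^ 2 * z ^ 2 + y ^ 2 * z ^ 2 - w * x * y * z = 0 →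
      (b₁ * x) ^ 2 * (b₂ * y) ^ 2 + (b₁ * x) ^ 2 * (b₃ * z) ^ 2 + (b₂ * y) ^ 2 * (b₃ * z) ^ 2
        - (l * w + a₁ * x + a₂ * y + a₃ * z) * (b₁ * x) * (b₂ * y) * (b₃ * z) = 0)
    (h : x ^ 2 + y ^ 2 + z ^ 2 = 0) :
    a₁ * x + a₂ * y + a₃ * z = 0 ∧ (b₁ * x) ^ 2 + (b₂ * y) ^ 2 + (b₃ * z) ^ 2 = 0 := by
  obtain ⟨⟨rfl, rfl, rfl⟩, h₂, h₃⟩ := monomial_automorphism hb₁ hb₂ hb₃ H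
  exact ⟨by ring, by linear_combination b₁ ^ 2 * h + y ^ 2 * h₂ + z ^ 2 * h₃⟩

/-- A matrix preserving the Roman surface maps each coordinate axis through the triple point to
a double line. -/
lemma double_line_of_mulVec {M : Matrix (Fin 4) (Fin 4) ℂ} (hM : M.det ≠ 0)
    (H : ∀ z, romanQ z = 0 → romanQ (M.mulVec z) = 0) (i : Fin 4) (hi : i ≠ 0) :
    ((M 2 0 = 0 ∧ M 2 i = 0) ∧ M 3 0 = 0 ∧ M 3 i = 0) ∨
      ((M 1 0 = 0 ∧ M 1 i = 0) ∧ M 3 0 = 0 ∧ M 3 i = 0) ∨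
      ((M 1 0 = 0 ∧ M 1 i = 0) ∧ M 2 0 = 0 ∧ M 2 i = 0) := by
  have hv : ∀ (s t : ℂ) (j : Fin 4),
      M.mulVec (s • Pi.single 0 1 + t • Pi.single i 1) j = s * M j 0 + t * M j i := by
    intro s t j
    simp [Matrix.mulVec_add, Matrix.mulVec_smul]
  refine line_classification (d₁ := M 0 0) (d₂ := M 0 i) (fun s t => ?_) (fun s t h₀ h₁ h₂ h₃ => ?_)
  · have h := H (s • Pi.single 0 1 + t • Pi.single i 1) (by
      fin_cases i <;> simp [romanQ] at hi ⊢)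
    simpa only [romanQ, hv] using h
  · have h : M.mulVec (s • Pi.single 0 1 + t • Pi.single i 1) = 0 := by
      funext j
      rw [hv]
      fin_cases j <;> assumption
    have h' := Matrix.eq_zero_of_mulVec_eq_zero hM h
    have e₀ := congrFun h' 0
    have e₁ := congrFun h' i
    simp [hi, hi.symm] at e₀ e₁
    exact ⟨e₀, e₁⟩

/-- A linear automorphism of the cone over the Roman surface preserves the cone over the absolute
conic. -/
lemma mulVec_absolute_conic {M : Matrix (Fin 4) (Fin 4) ℂ} (hM : M.det ≠ 0)
    (H : ∀ z, romanQ z = 0 → romanQ (M.mulVec z) = 0) (z : Fin 4 → ℂ)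
    (hz : z 0 = 0 ∧ z 1 ^ 2 + z 2 ^ 2 + z 3 ^ 2 = 0) :
    M.mulVec z 0 = 0 ∧ M.mulVec z 1 ^ 2 + M.mulVec z 2 ^ 2 + M.mulVec z 3 ^ 2 = 0 := by
  have Q : ∀ x y z w : ℂ, x ^ 2 * y ^ 2 + x ^ 2 * z ^ 2 + y ^ 2 * z ^ 2 - w * x * y * z = 0 →
      romanQ (M.mulVec ![w, x, y, z]) = 0 := fun x y z w h => H _ (by simpa [romanQ] using h)
  obtain ⟨hz₀, hz₁⟩ := hz
  have hdet := hM
  rw [Matrix.det_succ_row_zero] at hdet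
  simp [Matrix.det_fin_three, Fin.sum_univ_succ, Fin.succAbove] at hdet
  simp only [romanQ, Matrix.mulVec, dotProduct, Fin.sum_univ_four] at Q ⊢
  simp at Q
  rcases double_line_of_mulVec hM H 1 (by decide) with
    ⟨⟨p₁, p₂⟩, p₃, p₄⟩ | ⟨⟨p₁, p₂⟩, p₃, p₄⟩ | ⟨⟨p₁, p₂⟩, p₃, p₄⟩ <;>
  rcases double_line_of_mulVec hM H 2 (by decide) with
    ⟨⟨q₁, q₂⟩, q₃, q₄⟩ | ⟨⟨q₁, q₂⟩, q₃, q₄⟩ | ⟨⟨q₁, q₂⟩, q₃, q₄⟩ <;>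
  rcases double_line_of_mulVec hM H 3 (by decide) with
    ⟨⟨r₁, r₂⟩, r₃, r₄⟩ | ⟨⟨r₁, r₂⟩, r₃, r₄⟩ | ⟨⟨r₁, r₂⟩, r₃, r₄⟩ <;>
  simp [*] at hdet Q ⊢
  all_goals obtain ⟨-, ⟨hm₁, hm₂⟩, hm₃⟩ := hdet
  · exact (monomial_preserves_conic (l := M 0 0) hm₁ hm₂ hm₃
      (fun x y z w h => by linear_combination Q x y z w h) hz₁).imp_right
      fun h => by linear_combination h
  · exact (monomial_preserves_conic (l := M 0 0) hm₁ hm₃ hm₂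
      (fun x y z w h => by linear_combination Q x y z w h) hz₁).imp_right
      fun h => by linear_combination h
  · exact (monomial_preserves_conic (l := M 0 0) hm₂ hm₁ hm₃
      (fun x y z w h => by linear_combination Q x y z w h) hz₁).imp_right
      fun h => by linear_combination h
  · exact (monomial_preserves_conic (l := M 0 0) hm₂ hm₃ hm₁
      (fun x y z w h => by linear_combination Q x y z w h) hz₁).imp_right
      fun h => by linear_combination h
  · exact (monomial_preserves_conic (l := M 0 0) hm₃ hm₁ hm₂
      (fun x y z w h => by linear_combination Q x y z w h) hz₁).imp_right
      fun h => by linear_combination h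
  · exact (monomial_preserves_conic (l := M 0 0) hm₃ hm₂ hm₁
      (fun x y z w h => by linear_combination Q x y z w h) hz₁).imp_right
      fun h => by linear_combination h

lemma mk_mem_romanV {z : Fin 4 → ℂ} (hz : z ≠ 0) :
    Projectivization.mk ℂ z hz ∈ romanV ↔ romanQ z = 0 := by
  obtain ⟨a, ha⟩ := Projectivization.exists_smul_eq_mk_rep ℂ z hz
  have : romanQ (a • z) = (a : ℂ) ^ 4 * romanQ z := by
    simp only [romanQ, Units.smul_def, Pi.smul_apply, smul_eq_mul]
    ring
  simp [romanV, ← ha, this]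

lemma mk_mem_euclE {z : Fin 4 → ℂ} (hz : z ≠ 0) :
    Projectivization.mk ℂ z hz ∈ euclE ↔ z 0 = 0 ∧ z 1 ^ 2 + z 2 ^ 2 + z 3 ^ 2 = 0 := by
  obtain ⟨a, ha⟩ := Projectivization.exists_smul_eq_mk_rep ℂ z hz
  have : (a • z) 1 ^ 2 + (a • z) 2 ^ 2 + (a • z) 3 ^ 2
      = (a : ℂ) ^ 2 * (z 1 ^ 2 + z 2 ^ 2 + z 3 ^ 2) := by
    simp only [Units.smul_def, Pi.smul_apply, smul_eq_mul]
    ring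
  simp only [euclE, Set.mem_ofPred_eq, ← ha, this]
  simp [Units.smul_def]

lemma mulVec_ne_zero (A : GL (Fin 4) ℂ) {z : Fin 4 → ℂ} (hz : z ≠ 0) :
    (A : Matrix (Fin 4) (Fin 4) ℂ).mulVec z ≠ 0 := fun h =>
  hz (Matrix.eq_zero_of_mulVec_eq_zero ((Matrix.isUnit_iff_isUnit_det _).1 A.isUnit).ne_zero h)

lemma act_mk (A : GL (Fin 4) ℂ) {z : Fin 4 → ℂ} (hz : z ≠ 0) :
    act A (Projectivization.mk ℂ z hz) =
      Projectivization.mk ℂ ((A : Matrix (Fin 4) (Fin 4) ℂ).mulVec z) (mulVec_ne_zero A hz) :=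
  rfl

lemma act_act_inv (A : GL (Fin 4) ℂ) (p : Projectivization ℂ (Fin 4 → ℂ)) :
    act A (act A⁻¹ p) = p := by
  induction p using Projectivization.ind with
  | h z hz =>
    simp only [act_mk, Matrix.mulVec_mulVec, ← Units.val_mul, mul_inv_cancel, Units.val_one,
      Matrix.one_mulVec]

lemma act_mapsTo_euclE {A : GL (Fin 4) ℂ} (h : Set.MapsTo (act A) romanV romanV) :
    Set.MapsTo (act A) euclE euclE := by
  intro p
  induction p using Projectivization.ind with
  | h z hz =>
    rw [act_mk, mk_mem_euclE, mk_mem_euclE]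
    refine mulVec_absolute_conic ((Matrix.isUnit_iff_isUnit_det _).1 A.isUnit).ne_zero ?_ z
    intro w hw
    by_cases hw₀ : w = 0
    · simp [hw₀, romanQ]
    · have := h ((mk_mem_romanV hw₀).2 hw)
      rwa [act_mk, mk_mem_romanV] at this

/-- Every projective automorphism of the Roman surface is a Euclidean
isomorphism: it maps `E₃` onto itself. -/
theorem stmt2 (A : GL (Fin 4) ℂ) (h : act A '' romanV = romanV) :
    act A '' euclE = euclE := by
  have hinv : Set.MapsTo (act A⁻¹) romanV romanV := by
    intro p hp
    rw [← h] at hp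
    obtain ⟨q, hq, rfl⟩ := hp
    have := act_act_inv A⁻¹ q
    rw [inv_inv] at this
    rwa [this]
  refine Set.Subset.antisymm (act_mapsTo_euclE (Set.mapsTo_iff_image_subset.2 h.subset)).image_subset
    fun p hp => ⟨act A⁻¹ p, act_mapsTo_euclE hinv hp, act_act_inv A p⟩
end

section
/- The set of matrices C ∈ GL₃(ℂ), taken up to nonzero scalar multiples, such that each of the four polynomials fᵢ(C·(x₀,x₁,x₂)ᵀ) (i = 0,1,2,3) lies in the ℂ-linear span of {f₀, f₁, f₂, f₃} inside the space of quadratic forms in x₀,x₁,x₂, has exactly 24 elements. -/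
/-- The components of the parametrization of the Roman (Steiner) surface,
as quadratic forms (functions) on `ℂ³`. -/
noncomputable def romanF (x : Fin 3 → ℂ) : Fin 4 → ℂ :=
  ![x 0 ^ 2 + x 1 ^ 2 + x 2 ^ 2, x 0 * x 1, x 0 * x 2, x 1 * x 2]

/-- The set of invertible matrices `C` such that each component of `f ∘ C`
lies in the linear span of the components `f₀, f₁, f₂, f₃` of `f`. -/
noncomputable def compatSet : Set (Matrix (Fin 3) (Fin 3) ℂ) :=
  {C | IsUnit C ∧ ∀ i : Fin 4,
    (fun x : Fin 3 → ℂ => romanF (C.mulVec x) i) ∈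
      Submodule.span ℂ (Set.range fun i : Fin 4 => fun x : Fin 3 → ℂ => romanF x i)}

open Matrix

/-- `C` is compatible iff it is invertible and `romanF` takes the same value on its three columns. -/
lemma mem_compatSet_iff (C : Matrix (Fin 3) (Fin 3) ℂ) :
    C ∈ compatSet ↔ IsUnit C ∧ ∀ j, romanF (C.col j) = romanF (C.col 0) := by
  have span_iff (g : (Fin 3 → ℂ) → ℂ) :
      g ∈ Submodule.span ℂ (Set.range fun i : Fin 4 => fun x : Fin 3 → ℂ => romanF x i) ↔
        ∃ c : Fin 4 → ℂ, ∀ x, ∑ i, c i * romanF x i = g x := by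
    simp [Submodule.mem_span_range_iff_exists_fun, funext_iff]
  unfold compatSet
  simp only [Set.mem_ofPred_eq, span_iff]
  refine and_congr_right fun _ => ⟨fun h j => ?_, fun h i => ?_⟩
  · ext i
    obtain ⟨c, hc⟩ := h i
    have hcol (k : Fin 3) : romanF (C.col k) i = c 0 := by
      rw [← mulVec_single_one, ← hc]
      fin_cases k <;> simp [romanF, Fin.sum_univ_four]
    rw [hcol, hcol]
  · have h₁ := congrFun (h 1) i
    have h₂ := congrFun (h 2) i
    refine ⟨![romanF (C.col 0) i,
      romanF (C.col 0 + C.col 1) i - romanF (C.col 0) i - romanF (C.col 1) i,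
      romanF (C.col 0 + C.col 2) i - romanF (C.col 0) i - romanF (C.col 2) i,
      romanF (C.col 1 + C.col 2) i - romanF (C.col 1) i - romanF (C.col 2) i], fun x => ?_⟩
    fin_cases i <;>
      simp [romanF, Fin.sum_univ_four, mulVec, dotProduct, Fin.sum_univ_three] at h₁ h₂ ⊢ <;>
      linear_combination (-x 1 ^ 2) * h₁ + (-x 2 ^ 2) * h₂

/-- The signed permutation matrix whose column `j` is `± e (σ j)`, with sign `+` for `j = 0`. -/
noncomputable def signedPerm (p : Equiv.Perm (Fin 3) × (Fin 2 → ℤˣ)) :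
    Matrix (Fin 3) (Fin 3) ℂ :=
  of fun i j => if i = p.1 j then (((Fin.cons 1 p.2 : Fin 3 → ℤˣ) j : ℤ) : ℂ) else 0

lemma intUnit_cast_mul_self (u : ℤˣ) : ((u : ℤ) : ℂ) * ((u : ℤ) : ℂ) = 1 := by
  rcases Int.units_eq_one_or u with rfl | rfl <;> simp

lemma signedPerm_mem_compatSet (p : Equiv.Perm (Fin 3) × (Fin 2 → ℤˣ)) :
    signedPerm p ∈ compatSet := by
  rw [mem_compatSet_iff]
  constructor
  · refine IsUnit.of_mul_eq_one_right (signedPerm p)ᵀ ?_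
    ext j k
    by_cases hjk : j = k
    · subst hjk
      simp [mul_apply, signedPerm, intUnit_cast_mul_self]
    · simp [mul_apply, signedPerm, hjk, Ne.symm hjk]
  · have hcol (j : Fin 3) : romanF ((signedPerm p).col j) = ![1, 0, 0, 0] := by
      have hsq := intUnit_cast_mul_self ((Fin.cons 1 p.2 : Fin 3 → ℤˣ) j)
      simp only [romanF, col_apply, signedPerm, of_apply]
      generalize p.1 j = i
      fin_cases i <;> simp [pow_two, hsq]
    intro j
    rw [hcol, hcol]

/-- A compatible matrix has at most one nonzero entry in each column. -/
lemma mul_eq_zero_of_mem_compatSet {C : Matrix (Fin 3) (Fin 3) ℂ} (hC : C ∈ compatSet)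
    {i k : Fin 3} (hik : i ≠ k) (j : Fin 3) : C i j * C k j = 0 := by
  obtain ⟨hu, h⟩ := (mem_compatSet_iff C).1 hC
  have hdet : C.det ≠ 0 := ((isUnit_iff_isUnit_det C).1 hu).ne_zero
  have h01 (j) : C 0 j * C 1 j = C 0 0 * C 1 0 := by simpa [romanF] using congrFun (h j) 1
  have h02 (j) : C 0 j * C 2 j = C 0 0 * C 2 0 := by simpa [romanF] using congrFun (h j) 2
  have h12 (j) : C 1 j * C 2 j = C 1 0 * C 2 0 := by simpa [romanF] using congrFun (h j) 3
  have rows (a b : ℂ) (k l : Fin 3) (hkl : k ≠ l) (hab : ∀ j, a * C k j = b * C l j) :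
      a = 0 := by
    have hv : (a • (Pi.single k 1 : Fin 3 → ℂ) - b • Pi.single l 1) ᵥ* C = 0 := by
      ext j
      simp [sub_vecMul, smul_vecMul, hab]
    have := congrFun (eq_zero_of_vecMul_eq_zero hdet hv) k
    simpa [hkl] using this
  have p01 : C 0 0 * C 1 0 = 0 := rows _ (C 0 0 * C 2 0) 2 1 (by decide) fun j => by
    rw [← h01 j, ← h02 j]; ring
  have p02 : C 0 0 * C 2 0 = 0 := rows _ (C 0 0 * C 1 0) 1 2 (by decide) fun j => by
    rw [← h01 j, ← h02 j]; ring
  have p12 : C 1 0 * C 2 0 = 0 := rows _ (C 0 0 * C 2 0) 0 1 (by decide) fun j => by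
    rw [← h12 j, ← h02 j]; ring
  rw [p01] at h01
  rw [p02] at h02
  rw [p12] at h12
  fin_cases i <;> fin_cases k <;> first
    | exact absurd rfl hik
    | exact h01 j
    | exact h02 j
    | exact h12 j
    | exact (mul_comm _ _).trans (h01 j)
    | exact (mul_comm _ _).trans (h02 j)
    | exact (mul_comm _ _).trans (h12 j)

lemma exists_eq_smul_signedPerm {C : Matrix (Fin 3) (Fin 3) ℂ} (hC : C ∈ compatSet) :
    ∃ c : ℂ, c ≠ 0 ∧ ∃ p, C = c • signedPerm p := by
  obtain ⟨hu, h⟩ := (mem_compatSet_iff C).1 hC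
  have hdet : C.det ≠ 0 := ((isUnit_iff_isUnit_det C).1 hu).ne_zero
  have hne (j) : ∃ i, C i j ≠ 0 := by
    by_contra! hj
    exact hdet (det_eq_zero_of_column_eq_zero j hj)
  choose σ hσ using hne
  have hzero (i j) (hij : i ≠ σ j) : C i j = 0 :=
    (mul_eq_zero.1 (mul_eq_zero_of_mem_compatSet hC hij j)).resolve_right (hσ j)
  have hsurj : Function.Surjective σ := by
    intro i
    by_contra! hi
    exact hdet (det_eq_zero_of_row_eq_zero i fun j => hzero i j (hi j).symm)
  have hnorm (j) : ∑ i, C i j ^ 2 = C (σ j) j ^ 2 :=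
    Finset.sum_eq_single _ (fun i _ hi => by simp [hzero i j hi]) (by simp)
  have hsq (j) : C (σ j) j ^ 2 = C (σ 0) 0 ^ 2 := by
    rw [← hnorm, ← hnorm, Fin.sum_univ_three, Fin.sum_univ_three]
    simpa [romanF] using congrFun (h j) 0
  have hsign (j) : ∃ u : ℤˣ, C (σ j) j = C (σ 0) 0 * ((u : ℤ) : ℂ) := by
    rcases sq_eq_sq_iff_eq_or_eq_neg.1 (hsq j) with hj | hj
    · exact ⟨1, by simp [hj]⟩
    · exact ⟨-1, by simp [hj]⟩
  choose ε hε using hsign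
  refine ⟨C (σ 0) 0, hσ 0,
    (Equiv.ofBijective σ (Finite.surjective_iff_bijective.1 hsurj), fun k => ε k.succ), ?_⟩
  ext i j
  by_cases hij : i = σ j
  · subst hij
    refine Fin.cases ?_ (fun k => ?_) j
    · simp [signedPerm]
    · simpa [signedPerm] using hε k.succ
  · simp [signedPerm, hij, hzero i j hij]

lemma signedPerm_eq_of_eq_smul {p q : Equiv.Perm (Fin 3) × (Fin 2 → ℤˣ)} {c : ℂ}
    (h : signedPerm p = c • signedPerm q) : p = q := by
  have entry (i j) := congrFun (congrFun h i) j
  have hperm (j) : p.1 j = q.1 j := by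
    by_contra hj
    have := entry (p.1 j) j
    simp [signedPerm, hj] at this
  have hc : c = 1 := by
    have := entry (p.1 0) 0
    simpa [signedPerm, hperm, eq_comm] using this
  refine Prod.ext (Equiv.ext hperm) (funext fun k => Units.ext ?_)
  have := entry (p.1 k.succ) k.succ
  simpa [signedPerm, hperm, hc] using this

/-- Counted up to nonzero scalar multiples (i.e. counting the classes
`{c • C | c ≠ 0}`), there are exactly 24 such matrices. -/
theorem stmt4 :
    ((fun C : Matrix (Fin 3) (Fin 3) ℂ =>
        {D : Matrix (Fin 3) (Fin 3) ℂ | ∃ c : ℂ, c ≠ 0 ∧ D = c • C}) ''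
      compatSet).ncard = 24 := by
  set cls := fun C : Matrix (Fin 3) (Fin 3) ℂ =>
    {D : Matrix (Fin 3) (Fin 3) ℂ | ∃ c : ℂ, c ≠ 0 ∧ D = c • C}
  have cls_smul (c : ℂ) (hc : c ≠ 0) (C) : cls (c • C) = cls C := by
    ext D
    constructor
    · rintro ⟨d, hd, rfl⟩
      exact ⟨d * c, mul_ne_zero hd hc, smul_smul _ _ _⟩
    · rintro ⟨d, hd, rfl⟩
      exact ⟨d / c, div_ne_zero hd hc, by rw [smul_smul, div_mul_cancel₀ d hc]⟩
  have himage : cls '' compatSet = Set.range (cls ∘ signedPerm) := by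
    ext S
    constructor
    · rintro ⟨C, hC, rfl⟩
      obtain ⟨c, hc, p, rfl⟩ := exists_eq_smul_signedPerm hC
      exact ⟨p, (cls_smul c hc _).symm⟩
    · rintro ⟨p, rfl⟩
      exact ⟨_, signedPerm_mem_compatSet p, rfl⟩
  have hinj : Function.Injective (cls ∘ signedPerm) := by
    intro p q hpq
    have hp : signedPerm p ∈ cls (signedPerm q) := by
      rw [← show cls (signedPerm p) = cls (signedPerm q) from hpq]
      exact ⟨1, one_ne_zero, (one_smul _ _).symm⟩
    obtain ⟨c, -, h⟩ := hp
    exact signedPerm_eq_of_eq_smul h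
  rw [himage, ← Set.image_univ, Set.ncard_image_of_injective _ hinj, Set.ncard_univ,
    Nat.card_eq_fintype_card]
  simp [Fintype.card_perm, Nat.factorial]
end

section
/- For all nonzero c₃, c₇ ∈ ℂ, the polynomial x₀² divides each of the four polynomials gᵢ(x₀, c₃x₁, x₀, c₇x₂) (i = 0,1,2,3), and the four quotient polynomials gᵢ(x₀, c₃x₁, x₀, c₇x₂)/x₀² have no common non-constant polynomial factor (their greatest common divisor is a unit). In particular, the greatest common divisor of the four polynomials gᵢ(x₀, c₃x₁, x₀, c₇x₂) is x₀² up to a nonzero constant. -/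
open MvPolynomial

/-- The components of `g` as polynomials in `y₀, y₁, y₂, y₃`. -/
noncomputable def gP : Fin 4 → MvPolynomial (Fin 4) ℂ :=
  ![X 0 ^ 3 * X 1 ^ 2 * X 2 ^ 5,
    X 0 ^ 3 * X 1 ^ 2 * X 2 ^ 5 + X 1 ^ 5 * X 2 ^ 3 * X 3 ^ 2,
    X 0 ^ 2 * X 1 ^ 3 * X 3 ^ 5,
    X 0 ^ 4 * X 1 * X 2 ^ 3 * X 3 ^ 2 + X 0 ^ 5 * X 2 ^ 2 * X 3 ^ 3 +
      X 0 ^ 2 * X 1 ^ 3 * X 3 ^ 5]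

/-- The substitution `(y₀,y₁,y₂,y₃) = (x₀, c₃x₁, x₀, c₇x₂)` applied to `gᵢ`. -/
noncomputable def gSub (c₃ c₇ : ℂ) (i : Fin 4) : MvPolynomial (Fin 3) ℂ :=
  aeval ![X 0, C c₃ * X 1, X 0, C c₇ * X 2] (gP i)

/-- In a unique factorization domain, if only units divide every `q i`, then every common divisor
of the `a * q i` divides `a`. -/
theorem dvd_of_forall_dvd_mul_of_isUnit {R ι : Type*} [CommRing R] [IsDomain R]
    [UniqueFactorizationMonoid R] [Fintype ι] {a d : R} {q : ι → R}
    (hq : ∀ e : R, (∀ i, e ∣ q i) → IsUnit e) (hd : ∀ i, d ∣ a * q i) : d ∣ a := by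
  let := UniqueFactorizationMonoid.strongNormalizationMonoid (α := R)
  let := UniqueFactorizationMonoid.toNormalizedGCDMonoid R
  have hu : IsUnit (Finset.univ.gcd q) := hq _ fun i => Finset.gcd_dvd (Finset.mem_univ i)
  have h : d ∣ Finset.univ.gcd fun i => a * q i := Finset.dvd_gcd fun i _ => hd i
  exact hu.dvd_mul_right.mp ((Finset.gcd_mul_left' ..).dvd_iff_dvd_right.mp h)

/-- An irreducible divisor of `X i` does not divide a polynomial that is nonzero at some point
whose `i`-th coordinate vanishes. -/
theorem MvPolynomial.not_dvd_of_dvd_X_of_eval_ne_zero {σ K : Type*} [Field K] {i : σ}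
    {p f : MvPolynomial σ K} (hp : Irreducible p) (hpX : p ∣ X i) (x : σ → K) (hx : x i = 0)
    (hf : eval x f ≠ 0) : ¬ p ∣ f := by
  intro h
  have hX : X i ∣ f := (hp.dvd_symm (X_prime (i := i)).irreducible hpX).trans h
  have := map_dvd (eval x) hX
  rw [eval_X, hx, zero_dvd_iff] at this
  exact hf this

/-- The quotients of the `gSub c₃ c₇ i` by `X 0 ^ 2`. -/
noncomputable def gQuot (c₃ c₇ : ℂ) : Fin 4 → MvPolynomial (Fin 3) ℂ :=
  ![X 0 ^ 6 * (C c₃ * X 1) ^ 2,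
    X 0 ^ 6 * (C c₃ * X 1) ^ 2 + X 0 * (C c₃ * X 1) ^ 5 * (C c₇ * X 2) ^ 2,
    (C c₃ * X 1) ^ 3 * (C c₇ * X 2) ^ 5,
    X 0 ^ 5 * (C c₃ * X 1) * (C c₇ * X 2) ^ 2 + X 0 ^ 5 * (C c₇ * X 2) ^ 3 +
      (C c₃ * X 1) ^ 3 * (C c₇ * X 2) ^ 5]

theorem gSub_eq_mul_gQuot (c₃ c₇ : ℂ) (i : Fin 4) :
    gSub c₃ c₇ i = X 0 ^ 2 * gQuot c₃ c₇ i := by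
  fin_cases i <;> simp [gSub, gP, gQuot] <;> ring

theorem isUnit_of_forall_dvd_gQuot {c₃ c₇ : ℂ} (h₃ : c₃ ≠ 0) (h₇ : c₇ ≠ 0)
    {d : MvPolynomial (Fin 3) ℂ} (hd : ∀ i, d ∣ gQuot c₃ c₇ i) : IsUnit d := by
  by_contra hu
  have hd0 : d ≠ 0 := by
    rintro rfl
    have h := congrArg (eval ![1, 1, 1]) (zero_dvd_iff.mp (hd 0))
    simp [gQuot, h₃] at h
  obtain ⟨p, hp, hpd⟩ := WfDvdMonoid.exists_irreducible_factor hu hd0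
  have hunit : IsUnit (C c₃ : MvPolynomial (Fin 3) ℂ) := h₃.isUnit.map C
  have hp0 : p ∣ X 0 ^ 6 * (C c₃ * X 1) ^ 2 := hpd.trans (hd 0)
  rcases hp.prime.dvd_or_dvd hp0 with h | h
  · refine not_dvd_of_dvd_X_of_eval_ne_zero hp (hp.prime.dvd_of_dvd_pow h) ![0, 1, 1] rfl ?_
      (hpd.trans (hd 2))
    simp [gQuot, h₃, h₇]
  · have hX := hunit.dvd_mul_left.mp (hp.prime.dvd_of_dvd_pow h)
    refine not_dvd_of_dvd_X_of_eval_ne_zero hp hX ![1, 0, 1] rfl ?_ (hpd.trans (hd 3))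
    simp [gQuot, h₇]

theorem stmt8 (c₃ c₇ : ℂ) (h₃ : c₃ ≠ 0) (h₇ : c₇ ≠ 0) :
    (∀ i : Fin 4, (X 0 : MvPolynomial (Fin 3) ℂ) ^ 2 ∣ gSub c₃ c₇ i) ∧
    (∃ q : Fin 4 → MvPolynomial (Fin 3) ℂ,
      (∀ i : Fin 4, gSub c₃ c₇ i = X 0 ^ 2 * q i) ∧
      ∀ d : MvPolynomial (Fin 3) ℂ, (∀ i : Fin 4, d ∣ q i) → IsUnit d) ∧
    (∀ d : MvPolynomial (Fin 3) ℂ,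
      (∀ i : Fin 4, d ∣ gSub c₃ c₇ i) → d ∣ (X 0 : MvPolynomial (Fin 3) ℂ) ^ 2) := by
  have hq : ∀ d, (∀ i, d ∣ gQuot c₃ c₇ i) → IsUnit d :=
    fun _ => isUnit_of_forall_dvd_gQuot h₃ h₇
  refine ⟨fun i => ⟨_, gSub_eq_mul_gQuot c₃ c₇ i⟩,
    ⟨gQuot c₃ c₇, gSub_eq_mul_gQuot c₃ c₇, hq⟩, fun d hd => ?_⟩
  exact dvd_of_forall_dvd_mul_of_isUnit hq fun i => gSub_eq_mul_gQuot c₃ c₇ i ▸ hd i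
end
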